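/- Suppose G is connected and the family pb satisfies the self-add rule and the neighbor replacement rule (but not necessarily the direct messaging rule). If L = Δ(G) + 1, where Δ(G) is the maximum vertex degree of G, then the system is never in deadlock: there is no epoch t at which D(i,t) holds for every agent i ∈ A. (Theorem 2 of the paper.) -/

import Mathlib

theorem card_symmDiff_mem {A : Type*} [DecidableEq A] {P : Finset A} {i : A} (h : i ∈ P) :
    (symmDiff P {i}).card + 1 = P.card := by
  have : symmDiff P {i} = P.erase i := by
    ext x
    simp only [Finset.mem_symmDiff, Finset.mem_singleton, Finset.mem_erase]
    grind
  rw [this, Finset.card_erase_add_one h]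

theorem card_symmDiff_notMem {A : Type*} [DecidableEq A] {P : Finset A} {i : A} (h : i ∉ P) :
    (symmDiff P {i}).card = P.card + 1 := by
  have : symmDiff P {i} = insert i P := by
    ext x
    simp only [Finset.mem_symmDiff, Finset.mem_singleton, Finset.mem_insert]
    grind
  rw [this, Finset.card_insert_of_notMem h]

/-- Theorem 2: On a connected network, under the self-add rule and the neighbor
replacement rule (without the direct messaging rule), if `L = Δ(G) + 1` where
`Δ(G)` is the maximum vertex degree of `G`, then the system is never in
deadlock. -/
theorem theorem2_no_deadlock_maxdeg
    {A : Type*} [Fintype A] [DecidableEq A] [Nonempty A]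
    (G : SimpleGraph A) [DecidableRel G.Adj] (hconn : G.Connected)
    (pb : A → ℕ → Finset A) (L : ℕ) (hL : L = G.maxDegree + 1)
    (hself : ∀ i t, i ∉ pb i t → (pb i t).card < L → pb i (t + 1) ≠ pb i t)
    (hnbr : ∀ i j t, G.Adj i j →
      (symmDiff (pb i t) {i}).card < (symmDiff (pb j t) {i}).card →
      (pb i t).card < L → pb i (t + 1) ≠ pb i t) :
    ¬ ∃ t, ∀ i, pb i t = pb i (t + 1) ∧ (pb i t).card < L := by
  rintro ⟨t, ht⟩
  have hs : ∀ i, i ∈ pb i t := fun i => by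
    by_contra h
    exact hself i t h (ht i).2 (ht i).1.symm
  have hn : ∀ i j, G.Adj i j →
      (symmDiff (pb j t) {i}).card ≤ (symmDiff (pb i t) {i}).card := fun i j hij => by
    by_contra h
    exact hnbr i j t hij (not_le.mp h) (ht i).2 (ht i).1.symm
  have hm : ∀ i j, G.Adj i j → i ∈ pb j t := fun i j hij => by
    by_contra h
    have h1 := hn i j hij
    have h2 := hn j i hij.symm
    have e1 := card_symmDiff_mem (hs i)
    have e2 := card_symmDiff_mem (hs j)
    have e3 := card_symmDiff_notMem h
    by_cases h' : j ∈ pb i t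
    · have e4 := card_symmDiff_mem h'
      omega
    · have e4 := card_symmDiff_notMem h'
      omega
  obtain ⟨v, hv⟩ := G.exists_maximal_degree_vertex
  have hsub : insert v (G.neighborFinset v) ⊆ pb v t := by
    intro x hx
    rcases Finset.mem_insert.mp hx with rfl | hx
    · exact hs _
    · exact hm x v ((G.mem_neighborFinset v x).mp hx).symm
  have hc := Finset.card_le_card hsub
  rw [Finset.card_insert_of_notMem (by simp), G.card_neighborFinset_eq_degree] at hc
  have := (ht v).2
  omega
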